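/- arXiv:2409.18557 — 2 statements merged into one kernel-verified Lean document; each statement's English description precedes it below -/
import Mathlib

section
/- Under the scaling setup, ψ_k → 1 as k → ∞. -/
open Finset Filter Topology MeasureTheory

/-- Erlang's loss formula (Erlang-B): blocking probability of an M/GI/s/s queue
with offered load `a`. -/
noncomputable def erlangB (s : ℕ) (a : ℝ) : ℝ :=
  (a ^ s / Nat.factorial s) / ∑ ℓ ∈ Finset.range (s + 1), a ^ ℓ / Nat.factorial ℓ

/-- Standard normal density φ. -/
noncomputable def stdGaussianPDF (x : ℝ) : ℝ :=
  Real.exp (-x ^ 2 / 2) / Real.sqrt (2 * Real.pi)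

/-- Standard normal cumulative distribution function Φ. -/
noncomputable def stdGaussianCDF (x : ℝ) : ℝ :=
  ∫ t in Set.Iic x, stdGaussianPDF t

/-- Relative demand of class `i`: ϱ_i = α_i d_i n_i. -/
noncomputable def relDemand {C : ℕ} (n : Fin C → ℕ) (α d : Fin C → ℝ) (i : Fin C) : ℝ :=
  α i * d i * n i

/-- Total relative demand: ϱ = ∑ i, ϱ_i. -/
noncomputable def totDemand {C : ℕ} (n : Fin C → ℕ) (α d : Fin C → ℝ) : ℝ :=
  ∑ i, relDemand n α d i

/-- ψ_k = sup { x ∈ [0,1] : k - ∑_i ⌊x · k ϱ_i/(n_i f_k ϱ)⌋ n_i f_k ≥ max_i n_i f_k },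
with the convention `sSup ∅ = 0` of real numbers. -/
noncomputable def psi {C : ℕ} (n : Fin C → ℕ) (α d : Fin C → ℝ) (f : ℕ → ℕ) (k : ℕ) : ℝ :=
  sSup {x : ℝ | x ∈ Set.Icc (0 : ℝ) 1 ∧
    (k : ℝ) - ∑ i, (⌊x * ((k : ℝ) * relDemand n α d i /
        ((n i : ℝ) * (f k : ℝ) * totDemand n α d))⌋ : ℝ) * ((n i : ℝ) * (f k : ℝ))
      ≥ ((Finset.univ.sup (fun i => n i * f k) : ℕ) : ℝ)}

/-- Number of class-`i` "virtual servers": s_i^(k) = ⌊ψ_k · k ϱ_i/(n_i f_k ϱ)⌋. -/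
noncomputable def srv {C : ℕ} (n : Fin C → ℕ) (α d : Fin C → ℝ) (f : ℕ → ℕ)
    (i : Fin C) (k : ℕ) : ℕ :=
  ⌊psi n α d f k * ((k : ℝ) * relDemand n α d i /
      ((n i : ℝ) * (f k : ℝ) * totDemand n α d))⌋₊

/-- θ_i = θ √(ϱ_i/(n_i ϱ)). -/
noncomputable def thetaI {C : ℕ} (n : Fin C → ℕ) (α d : Fin C → ℝ) (θ : ℝ) (i : Fin C) : ℝ :=
  θ * Real.sqrt (relDemand n α d i / ((n i : ℝ) * totDemand n α d))

lemma totDemand_pos {C : ℕ} (hC : 0 < C) {n : Fin C → ℕ} (hn : ∀ i, 0 < n i)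
    {α d : Fin C → ℝ} (hα : ∀ i, 0 < α i) (hd : ∀ i, 0 < d i) : 0 < totDemand n α d := by
  have : Nonempty (Fin C) := ⟨⟨0, hC⟩⟩
  refine Finset.sum_pos (fun i _ => ?_) Finset.univ_nonempty
  exact mul_pos (mul_pos (hα i) (hd i)) (Nat.cast_pos.mpr (hn i))

lemma psi_le_one {C : ℕ} (n : Fin C → ℕ) (α d : Fin C → ℝ) (f : ℕ → ℕ) (k : ℕ) :
    psi n α d f k ≤ 1 :=
  Real.sSup_le (fun _ hx => hx.1.2) zero_le_one

/-- The integer parts of a fraction `x` of the proportional allocation use at most `x * k`. -/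
lemma sum_floor_mul_le {C : ℕ} {n : Fin C → ℕ} (hn : ∀ i, 0 < n i) {α d : Fin C → ℝ}
    (hT : totDemand n α d ≠ 0) {f : ℕ → ℕ} {k : ℕ} (hf : 0 < f k) (x : ℝ) :
    ∑ i, (⌊x * ((k : ℝ) * relDemand n α d i /
        ((n i : ℝ) * (f k : ℝ) * totDemand n α d))⌋ : ℝ) * ((n i : ℝ) * (f k : ℝ)) ≤ x * k := by
  have hf' : (0 : ℝ) < f k := Nat.cast_pos.mpr hf
  calc _ ≤ ∑ i, x * k / totDemand n α d * relDemand n α d i := by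
        refine Finset.sum_le_sum fun i _ => ?_
        have hni : (0 : ℝ) < n i := Nat.cast_pos.mpr (hn i)
        refine (mul_le_mul_of_nonneg_right (Int.floor_le _) (by positivity)).trans_eq ?_
        field_simp
    _ = x * k := by
        rw [← Finset.mul_sum, ← totDemand, div_mul_cancel₀ _ hT]

lemma one_sub_le_psi {C : ℕ} {n : Fin C → ℕ} (hn : ∀ i, 0 < n i) {α d : Fin C → ℝ}
    (hT : totDemand n α d ≠ 0) {f : ℕ → ℕ} {k : ℕ} (hf : 0 < f k) (hk : 0 < k)
    (hle : ((Finset.univ.sup n : ℕ) : ℝ) * ((f k : ℝ) / k) ≤ 1) :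
    1 - ((Finset.univ.sup n : ℕ) : ℝ) * ((f k : ℝ) / k) ≤ psi n α d f k := by
  have hk' : (0 : ℝ) < k := Nat.cast_pos.mpr hk
  refine le_csSup ⟨1, fun _ hx => hx.1.2⟩ ⟨⟨sub_nonneg.mpr hle, ?_⟩, ?_⟩
  · exact sub_le_self _ (by positivity)
  · have hsup : ((Finset.univ.sup (fun i => n i * f k) : ℕ) : ℝ) ≤
        ((Finset.univ.sup n : ℕ) : ℝ) * f k := by
      exact_mod_cast Finset.sup_le fun i hi => Nat.mul_le_mul_right _ (Finset.le_sup hi)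
    have hsum := sum_floor_mul_le hn hT hf
      (1 - ((Finset.univ.sup n : ℕ) : ℝ) * ((f k : ℝ) / k))
    have hx : (1 - ((Finset.univ.sup n : ℕ) : ℝ) * ((f k : ℝ) / k)) * k =
        k - ((Finset.univ.sup n : ℕ) : ℝ) * f k := by
      field_simp
    linarith

/-- ψ_k → 1 as k → ∞. -/
theorem psi_tendsto_one
    (C : ℕ) (hC : 0 < C) (n : Fin C → ℕ) (hn : ∀ i, 0 < n i)
    (α d : Fin C → ℝ) (hα : ∀ i, 0 < α i) (hd : ∀ i, 0 < d i)
    (hsum : ∑ i, α i = 1)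
    (f : ℕ → ℕ) (hf : ∀ k, 0 < f k)
    (hfk : Tendsto (fun k : ℕ => (f k : ℝ) / k) atTop (𝓝 0)) :
    Tendsto (fun k : ℕ => psi n α d f k) atTop (𝓝 1) := by
  have hlim := hfk.const_mul ((Finset.univ.sup n : ℕ) : ℝ)
  rw [mul_zero] at hlim
  have hlow := hlim.const_sub 1
  rw [sub_zero] at hlow
  refine tendsto_of_tendsto_of_tendsto_of_le_of_le' hlow tendsto_const_nhds ?_
    (Eventually.of_forall fun k => psi_le_one n α d f k)
  filter_upwards [hlim.eventually_le_const zero_lt_one, eventually_gt_atTop 0] with k hle hk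
  exact one_sub_le_psi hn (totDemand_pos hC hn hα hd).ne' (hf k) hk hle
end

section
/- Under the critically loaded scaling, √(k/f_k) · ∑_{i=1}^C α_i · E_{s_i^{(k)}}(λ^{(k)} α_i d_i) → θ · ∑_{i=1}^C (α_i/θ_i) · φ(θ_i)/Φ(θ_i) as k → ∞, where θ_i := θ · √(ϱ_i/(n_i ϱ)). (In particular, the left-hand side quantity equals the scaled probability that an arriving job is routed to the helper set under the modified Balanced-Splitting policy, so this limit gives the bound of Theorem 2.) -/
open Finset Filter Topology MeasureTheory

lemma Real.log_one_add_le_sub_sq_div {y : ℝ} (hy : 0 ≤ y) :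
    Real.log (1 + y) ≤ y - y ^ 2 / (2 * (1 + y)) := by
  have h1 : 0 < 1 + y := by linarith
  have h := Real.self_le_sinh_iff.2 (Real.log_nonneg (by linarith : 1 ≤ 1 + y))
  rw [Real.sinh_log h1] at h
  refine h.trans_eq ?_
  field_simp
  ring

lemma sq_mul_log_one_add_div_sub_le {q w : ℝ} (hq : 0 < q) (hw : 0 ≤ w) :
    q ^ 2 * Real.log (1 + w / q) - q * w ≤ -(w ^ 2 / (2 * (1 + w / q))) := by
  have h := mul_le_mul_of_nonneg_left
    (Real.log_one_add_le_sub_sq_div (div_nonneg hw hq.le)) (sq_nonneg q)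
  have e : q ^ 2 * (w / q - (w / q) ^ 2 / (2 * (1 + w / q)))
      = q * w - w ^ 2 / (2 * (1 + w / q)) := by
    have : 0 < q + w := by linarith
    field_simp
  linarith

lemma le_sq_mul_log_one_add_div_sub {q w : ℝ} (hq : 0 < q) (hw : 0 ≤ w) :
    -(w ^ 2 / (w / q + 2)) ≤ q ^ 2 * Real.log (1 + w / q) - q * w := by
  have h := mul_le_mul_of_nonneg_left
    (Real.le_log_one_add_of_nonneg (div_nonneg hw hq.le)) (sq_nonneg q)
  have e : q ^ 2 * (2 * (w / q) / (w / q + 2)) = q * w - w ^ 2 / (w / q + 2) := by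
    have : 0 < w + q * 2 := by linarith
    field_simp
    ring
  linarith

lemma sq_mul_log_one_add_div_sub_le_linear {p q w : ℝ} (hp : 0 < p) (hpq : p ≤ q) (hw : 0 ≤ w) :
    q ^ 2 * Real.log (1 + w / q) - q * w ≤ (p ^ 2 - p * w) / 2 := by
  have hq : 0 < q := hp.trans_le hpq
  refine (sq_mul_log_one_add_div_sub_le hq hw).trans ?_
  have hqw : 0 < q + w := by linarith
  have e : w ^ 2 / (2 * (1 + w / q)) = q * w ^ 2 / (q + w) / 2 := by
    field_simp
  have : p * w - p ^ 2 ≤ q * w ^ 2 / (q + w) := by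
    have h : 0 ≤ w ^ 2 - p * w + p ^ 2 := by nlinarith [sq_nonneg (w - p), mul_nonneg hp.le hw]
    rw [le_div_iff₀ hqw]
    nlinarith [mul_nonneg (sub_nonneg.2 hpq) h, pow_pos hp 3]
  rw [e]
  linarith

lemma tendsto_sq_mul_log_one_add_div_sub {w : ℝ} (hw : 0 ≤ w) :
    Tendsto (fun q : ℝ => q ^ 2 * Real.log (1 + w / q) - q * w) atTop (𝓝 (-(w ^ 2 / 2))) := by
  have h0 : Tendsto (fun q : ℝ => w / q) atTop (𝓝 0) := tendsto_const_nhds.div_atTop tendsto_id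
  refine tendsto_of_tendsto_of_tendsto_of_le_of_le' (g := fun q => -(w ^ 2 / (w / q + 2)))
    (h := fun q => -(w ^ 2 / (2 * (1 + w / q)))) ?_ ?_ ?_ ?_
  · simpa using (tendsto_const_nhds.div (h0.add_const 2) (by norm_num)).neg
  · simpa using (tendsto_const_nhds.div ((h0.const_add 1).const_mul 2) (by norm_num)).neg
  · filter_upwards [eventually_gt_atTop 0] with q hq using le_sq_mul_log_one_add_div_sub hq hw
  · filter_upwards [eventually_gt_atTop 0] with q hq using sq_mul_log_one_add_div_sub_le hq hw

lemma one_add_div_sqrt_pow_mul_exp {s : ℕ} (hs : 0 < s) (a : ℝ) {w : ℝ} (hw : 0 ≤ w) :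
    (1 + w / √s) ^ s * Real.exp (-(a / √s * w)) =
      Real.exp (((s - a) / √s) * w + ((√s) ^ 2 * Real.log (1 + w / √s) - √s * w)) := by
  have hq : 0 < √(s : ℝ) := Real.sqrt_pos.2 (by exact_mod_cast hs)
  have h1 : 0 < 1 + w / √s := by positivity
  have hsq : (√(s : ℝ)) ^ 2 = s := Real.sq_sqrt (Nat.cast_nonneg s)
  have e : ((s - a) / √s) * w + ((√s) ^ 2 * Real.log (1 + w / √s) - √s * w)
      = (s : ℝ) * Real.log (1 + w / √s) + -(a / √s * w) := by
    rw [hsq, sub_div, show (s : ℝ) / √s = √s from Real.div_sqrt]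
    ring
  rw [e, Real.exp_add, Real.exp_nat_mul, Real.exp_log h1]

lemma integrableOn_pow_mul_exp_neg_mul {c : ℝ} (hc : 0 < c) (j : ℕ) :
    IntegrableOn (fun w : ℝ => w ^ j * Real.exp (-(c * w))) (Set.Ioi 0) := by
  have h := integrableOn_rpow_mul_exp_neg_mul_rpow (p := 1) (s := j) (b := c)
    (by have := Nat.cast_nonneg (α := ℝ) j; linarith) one_pos hc
  simpa using h

lemma integral_pow_mul_exp_neg_mul {c : ℝ} (hc : 0 < c) (j : ℕ) :
    ∫ w in Set.Ioi (0 : ℝ), w ^ j * Real.exp (-(c * w)) = j.factorial / c ^ (j + 1) := by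
  have h := Real.integral_rpow_mul_exp_neg_mul_Ioi (a := j + 1) (r := c) (by positivity) hc
  rw [Real.Gamma_nat_eq_factorial] at h
  have e : ((1 / c) ^ ((j : ℝ) + 1)) = 1 / c ^ (j + 1) := by
    rw [← Nat.cast_succ, Real.rpow_natCast, one_div_pow]
  rw [e] at h
  simp only [add_sub_cancel_right, Real.rpow_natCast] at h
  rw [h]
  ring

lemma inv_erlangB_eq_integral (s : ℕ) {a r : ℝ} (ha : 0 < a) (hr : 0 < r) :
    (erlangB s a)⁻¹ =
      a * r * ∫ w in Set.Ioi (0 : ℝ), (1 + w * r) ^ s * Real.exp (-(a * r * w)) := by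
  have hc : 0 < a * r := mul_pos ha hr
  have e : ∀ w : ℝ, (1 + w * r) ^ s * Real.exp (-(a * r * w)) =
      ∑ j ∈ Finset.range (s + 1),
        (r ^ j * s.choose j) * (w ^ j * Real.exp (-(a * r * w))) := by
    intro w
    rw [add_comm, add_pow, Finset.sum_mul]
    refine Finset.sum_congr rfl fun j _ => ?_
    rw [mul_pow, one_pow]
    ring
  simp_rw [e]
  rw [integral_finsetSum _ fun j _ => (integrableOn_pow_mul_exp_neg_mul hc j).const_mul _]
  simp_rw [integral_const_mul, integral_pow_mul_exp_neg_mul hc]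
  rw [erlangB, inv_div, Finset.sum_div, Finset.mul_sum, ← Finset.sum_range_reflect]
  refine Finset.sum_congr rfl fun j hj => ?_
  have hjs : j ≤ s := Nat.lt_succ_iff.1 (Finset.mem_range.1 hj)
  have hch : (s.choose j : ℝ) * j.factorial * (s - j).factorial = s.factorial := by
    exact_mod_cast Nat.choose_mul_factorial_mul_factorial hjs
  have hpow : a ^ s = a ^ (s - j) * a ^ j := by rw [← pow_add, Nat.sub_add_cancel hjs]
  have hf : ((s - j).factorial : ℝ) ≠ 0 := by exact_mod_cast Nat.factorial_ne_zero _
  rw [show s + 1 - 1 - j = s - j by omega, hpow, ← hch, mul_pow, pow_succ a, pow_succ r]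
  field_simp

lemma stdGaussianPDF_pos (x : ℝ) : 0 < stdGaussianPDF x := by
  unfold stdGaussianPDF
  positivity

lemma integrable_stdGaussianPDF : Integrable stdGaussianPDF := by
  refine ((integrable_exp_neg_mul_sq (by norm_num : (0 : ℝ) < 1 / 2)).div_const
    (√(2 * Real.pi))).congr (.of_forall fun x => ?_)
  simp only [stdGaussianPDF]
  congr 2
  ring

lemma stdGaussianCDF_pos (x : ℝ) : 0 < stdGaussianCDF x := by
  rw [stdGaussianCDF, setIntegral_pos_iff_support_of_nonneg_ae
    (.of_forall fun t => (stdGaussianPDF_pos t).le) integrable_stdGaussianPDF.integrableOn,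
    Function.support_eq_univ fun t => (stdGaussianPDF_pos t).ne', Set.univ_inter, Real.volume_Iic]
  exact ENNReal.zero_lt_top

lemma integral_exp_mul_sub_sq_div_two (β : ℝ) :
    ∫ w in Set.Ioi (0 : ℝ), Real.exp (β * w + -(w ^ 2 / 2)) =
      stdGaussianCDF β / stdGaussianPDF β := by
  rw [eq_div_iff (stdGaussianPDF_pos β).ne', mul_comm, ← integral_const_mul, stdGaussianCDF,
    integral_Iic_eq_integral_Iio, ← integral_indicator measurableSet_Iio,
    ← integral_indicator measurableSet_Ioi,
    ← integral_sub_left_eq_self (Set.indicator (Set.Iio β) stdGaussianPDF) _ β]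
  congr 1
  ext w
  by_cases hw : 0 < w
  · rw [Set.indicator_of_mem (Set.mem_Ioi.2 hw), Set.indicator_of_mem (by simpa using hw),
      stdGaussianPDF, stdGaussianPDF, div_mul_eq_mul_div, ← Real.exp_add]
    congr 2
    ring
  · rw [Set.indicator_of_notMem (by simpa using hw), Set.indicator_of_notMem (by simpa using hw)]

/-- The Erlang loss formula in the quality-and-efficiency-driven (Halfin–Whitt) regime. -/
lemma tendsto_sqrt_mul_erlangB {s : ℕ → ℕ} {a : ℕ → ℝ} {β : ℝ} (hs : Tendsto s atTop atTop)
    (ha : ∀ k, 0 < a k) (hβ : Tendsto (fun k => (s k - a k) / √(s k)) atTop (𝓝 β)) :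
    Tendsto (fun k => √(s k) * erlangB (s k) (a k)) atTop
      (𝓝 (stdGaussianPDF β / stdGaussianCDF β)) := by
  have hq : Tendsto (fun k => √(s k : ℝ)) atTop atTop :=
    Real.tendsto_sqrt_atTop.comp (tendsto_natCast_atTop_atTop.comp hs)
  have hspos : ∀ᶠ k in atTop, 0 < s k := hs.eventually_gt_atTop 0
  have hint : Tendsto (fun k => ∫ w in Set.Ioi (0 : ℝ),
      (1 + w / √(s k)) ^ (s k) * Real.exp (-(a k / √(s k) * w))) atTop
      (𝓝 (stdGaussianCDF β / stdGaussianPDF β)) := by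
    rw [← integral_exp_mul_sub_sq_div_two]
    set p : ℝ := 2 * (|β| + 2) with hp
    have hp0 : 0 < p := by positivity
    refine tendsto_integral_filter_of_dominated_convergence
      (fun w => Real.exp (p ^ 2 / 2) * Real.exp (-1 * w)) ?_ ?_ ?_ ?_
    · exact .of_forall fun k => by fun_prop
    · filter_upwards [hspos, hq.eventually_ge_atTop p,
        hβ.eventually_le_const (lt_of_le_of_lt (le_abs_self β) (lt_add_one _))] with k h1 h2 h3
      filter_upwards [ae_restrict_mem measurableSet_Ioi] with w hw
      have hw0 : 0 ≤ w := le_of_lt hw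
      rw [one_add_div_sqrt_pow_mul_exp h1 _ hw0, Real.norm_of_nonneg (Real.exp_nonneg _),
        ← Real.exp_add, Real.exp_le_exp]
      have h4 := sq_mul_log_one_add_div_sub_le_linear hp0 h2 hw0
      have h5 := mul_le_mul_of_nonneg_right h3 hw0
      have h6 : p * w = 2 * (|β| + 2) * w := by rw [hp]
      linarith
    · exact (exp_neg_integrableOn_Ioi 0 one_pos).const_mul _
    · filter_upwards [ae_restrict_mem measurableSet_Ioi] with w hw
      have hw0 : 0 ≤ w := le_of_lt hw
      refine Tendsto.congr' ?_ (Real.continuous_exp.continuousAt.tendsto.comp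
        ((hβ.mul_const w).add ((tendsto_sq_mul_log_one_add_div_sub hw0).comp hq)))
      filter_upwards [hspos] with k h1
      exact (one_add_div_sqrt_pow_mul_exp h1 _ hw0).symm
  have hCDF : stdGaussianCDF β / stdGaussianPDF β ≠ 0 :=
    (div_pos (stdGaussianCDF_pos β) (stdGaussianPDF_pos β)).ne'
  have hratio : Tendsto (fun k => a k / s k) atTop (𝓝 1) := by
    have h := (hβ.mul (tendsto_inv_atTop_zero.comp hq)).const_sub 1
    rw [mul_zero, sub_zero] at h
    refine h.congr' ?_
    filter_upwards [hspos] with k h1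
    have h2 : (0 : ℝ) < s k := by exact_mod_cast h1
    have h3 : √(s k : ℝ) * √(s k) = s k := Real.mul_self_sqrt h2.le
    simp only [Function.comp]
    rw [← div_eq_mul_inv, div_div, h3]
    field_simp
    ring
  have h := (hratio.mul hint).inv₀ (by simpa using hCDF)
  rw [one_mul, inv_div] at h
  refine h.congr' ?_
  filter_upwards [hspos] with k h1
  have h2 : (0 : ℝ) < s k := by exact_mod_cast h1
  have h3 : √(s k : ℝ) * √(s k) = s k := Real.mul_self_sqrt h2.le
  have h4 : 0 < √(s k : ℝ) := Real.sqrt_pos.2 h2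
  have h5 := inv_erlangB_eq_integral (s k) (ha k) (inv_pos.2 h4)
  simp only [← div_eq_mul_inv] at h5
  rw [← inv_inv (√(s k : ℝ) * erlangB (s k) (a k)), mul_inv (√(s k : ℝ)), h5, ← mul_assoc]
  congr 2
  nth_rewrite 1 [← h3]
  field_simp

lemma psi_nonneg {C : ℕ} (n : Fin C → ℕ) (α d : Fin C → ℝ) (f : ℕ → ℕ) (k : ℕ) :
    0 ≤ psi n α d f k :=
  Real.sSup_nonneg fun _ hx => hx.1.1

lemma le_psi {C : ℕ} {n : Fin C → ℕ} (hn : ∀ i, 0 < n i) {α d : Fin C → ℝ}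
    (htot : 0 < totDemand n α d) {f : ℕ → ℕ} {k : ℕ} (hk : 0 < k) (hf : 0 < f k) :
    1 - (Finset.univ.sup n : ℕ) * f k / k ≤ psi n α d f k := by
  have hk' : (0 : ℝ) < k := by exact_mod_cast hk
  have hf' : (0 : ℝ) < f k := by exact_mod_cast hf
  rcases le_or_gt (1 - ((Finset.univ.sup n : ℕ) : ℝ) * f k / k) 0 with h | h
  · exact h.trans (psi_nonneg n α d f k)
  · refine le_csSup ⟨1, fun x hx => hx.1.2⟩ ⟨⟨h.le, ?_⟩, ?_⟩
    · rw [sub_le_self_iff]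
      positivity
    · set x := 1 - ((Finset.univ.sup n : ℕ) : ℝ) * f k / k with hx
      have hsup : Finset.univ.sup (fun i => n i * f k) ≤ Finset.univ.sup n * f k :=
        Finset.sup_le fun i _ => Nat.mul_le_mul_right _ (Finset.le_sup (Finset.mem_univ i))
      have hsup' : ((Finset.univ.sup (fun i => n i * f k) : ℕ) : ℝ)
          ≤ (Finset.univ.sup n : ℕ) * f k := by exact_mod_cast hsup
      have hsum : ∑ i, (⌊x * ((k : ℝ) * relDemand n α d i /
          ((n i : ℝ) * (f k : ℝ) * totDemand n α d))⌋ : ℝ) * ((n i : ℝ) * (f k : ℝ))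
          ≤ ∑ i, x * k / totDemand n α d * relDemand n α d i := by
        refine Finset.sum_le_sum fun i _ => ?_
        have hni : (0 : ℝ) < n i := by exact_mod_cast hn i
        refine (mul_le_mul_of_nonneg_right (Int.floor_le _) (by positivity)).trans_eq ?_
        field_simp
      rw [← Finset.mul_sum] at hsum
      change _ ≤ _ * totDemand n α d at hsum
      rw [div_mul_cancel₀ _ htot.ne'] at hsum
      have hxk : x * k = k - (Finset.univ.sup n : ℕ) * f k := by
        rw [hx]
        field_simp
      linarith

lemma abs_srv_sub_le {C : ℕ} {n : Fin C → ℕ} (hn : ∀ i, 0 < n i) {α d : Fin C → ℝ}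
    (htot : 0 < totDemand n α d) {f : ℕ → ℕ} {k : ℕ} (hk : 0 < k) (hf : 0 < f k) {i : Fin C}
    (hi : 0 < relDemand n α d i) :
    |srv n α d f i k - k / f k * (relDemand n α d i / (n i * totDemand n α d))| ≤
      (Finset.univ.sup n : ℕ) * (relDemand n α d i / (n i * totDemand n α d)) + 1 := by
  have hk' : (0 : ℝ) < k := by exact_mod_cast hk
  have hf' : (0 : ℝ) < f k := by exact_mod_cast hf
  have hni : (0 : ℝ) < n i := by exact_mod_cast hn i
  set b := relDemand n α d i / (n i * totDemand n α d) with hb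
  have hb0 : 0 < b := by positivity
  have e : (k : ℝ) * relDemand n α d i / ((n i : ℝ) * (f k : ℝ) * totDemand n α d)
      = k / f k * b := by
    rw [hb]
    field_simp
  have hψ := psi_nonneg n α d f k
  have hmb : 0 ≤ k / f k * b := by positivity
  have h1 := Nat.floor_le (mul_nonneg hψ hmb)
  have h2 := Nat.lt_floor_add_one (psi n α d f k * (k / f k * b))
  have h3 := mul_le_mul_of_nonneg_right (psi_le_one n α d f k) hmb
  have h4 := mul_le_mul_of_nonneg_right (le_psi hn (α := α) (d := d) htot hk hf) hmb
  have h5 : (1 - ((Finset.univ.sup n : ℕ) : ℝ) * f k / k) * (k / f k * b)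
      = k / f k * b - (Finset.univ.sup n : ℕ) * b := by
    field_simp
  have h6 : 0 ≤ ((Finset.univ.sup n : ℕ) : ℝ) * b := by positivity
  rw [srv, e, abs_le]
  constructor <;> linarith

/-- If the number of servers is within a bounded distance of `m * b`, the load per unit is
`m * b * ρ`, and `(1 - ρ) * √m → θ`, then the loss probability is of order `1 / √m`. -/
lemma tendsto_sqrt_mul_erlangB_of_critical {s : ℕ → ℕ} {m ρ : ℕ → ℝ} {b K θ : ℝ} (hb : 0 < b)
    (hm : Tendsto m atTop atTop) (hs : ∀ᶠ k in atTop, |s k - m k * b| ≤ K)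
    (hρ : ∀ᶠ k in atTop, 0 < ρ k)
    (hcrit : Tendsto (fun k => (1 - ρ k) * √(m k)) atTop (𝓝 θ)) :
    Tendsto (fun k => √(m k) * erlangB (s k) (m k * b * ρ k)) atTop
      (𝓝 ((√b)⁻¹ * (stdGaussianPDF (θ * √b) / stdGaussianCDF (θ * √b)))) := by
  have hmpos := hm.eventually_gt_atTop 0
  have hsm : Tendsto (fun k => (s k : ℝ) / m k) atTop (𝓝 b) := by
    have h0 : Tendsto (fun k => (s k - m k * b) / m k) atTop (𝓝 0) := by
      refine squeeze_zero_norm' ?_ (tendsto_const_nhds (x := K) |>.div_atTop hm)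
      filter_upwards [hmpos, hs] with k h1 h2
      rw [norm_div, Real.norm_of_nonneg h1.le, Real.norm_eq_abs]
      gcongr
    have h := h0.add_const b
    rw [zero_add] at h
    refine h.congr' ?_
    filter_upwards [hmpos] with k h1
    field_simp
    ring
  have hsR : Tendsto (fun k => (s k : ℝ)) atTop atTop := by
    refine (hsm.pos_mul_atTop hb hm).congr' ?_
    filter_upwards [hmpos] with k h1
    field_simp
  have hsN : Tendsto s atTop atTop := tendsto_natCast_atTop_iff.1 hsR
  have hspos := hsR.eventually_gt_atTop 0
  have hq : Tendsto (fun k => √(s k : ℝ)) atTop atTop := Real.tendsto_sqrt_atTop.comp hsR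
  have hms : Tendsto (fun k => √(m k) / √(s k)) atTop (𝓝 (√b)⁻¹) := by
    refine (((Real.continuous_sqrt.tendsto b).comp hsm).inv₀ (Real.sqrt_pos.2 hb).ne').congr ?_
    intro k
    simp only [Function.comp]
    rw [Real.sqrt_div (Nat.cast_nonneg _), inv_div]
  have hβ : Tendsto (fun k => (s k - m k * b * ρ k) / √(s k)) atTop (𝓝 (θ * √b)) := by
    have h0 : Tendsto (fun k => (s k - m k * b) / √(s k)) atTop (𝓝 0) := by
      refine squeeze_zero_norm' ?_ (tendsto_const_nhds (x := K) |>.div_atTop hq)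
      filter_upwards [hs] with k h2
      rw [norm_div, Real.norm_of_nonneg (Real.sqrt_nonneg _), Real.norm_eq_abs]
      gcongr
    have h := h0.add ((hcrit.mul hms).const_mul b)
    have e : 0 + b * (θ * (√b)⁻¹) = θ * √b := by
      have h1 : √b * √b = b := Real.mul_self_sqrt hb.le
      have h2 : 0 < √b := Real.sqrt_pos.2 hb
      field_simp
      rw [sq, h1]
      ring
    rw [e] at h
    refine h.congr' ?_
    filter_upwards [hmpos] with k h1
    have h3 : √(m k) * √(m k) = m k := Real.mul_self_sqrt h1.le
    calc _ = (s k - m k * b + b * (1 - ρ k) * (√(m k) * √(m k))) / √(s k) := by ring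
      _ = _ := by rw [h3]; ring
  set a : ℕ → ℝ := fun k => if 0 < m k * b * ρ k then m k * b * ρ k else 1 with ha
  have hae : ∀ᶠ k in atTop, a k = m k * b * ρ k := by
    filter_upwards [hmpos, hρ] with k h1 h2
    exact if_pos (by positivity)
  have hapos : ∀ k, 0 < a k := by
    intro k
    simp only [ha]
    split_ifs with h
    exacts [h, one_pos]
  have hmain := hms.mul (tendsto_sqrt_mul_erlangB hsN hapos (hβ.congr' (by
    filter_upwards [hae] with k h
    rw [h])))
  refine hmain.congr' ?_
  filter_upwards [hae, hspos] with k h1 h2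
  have h3 : 0 < √(s k : ℝ) := Real.sqrt_pos.2 h2
  rw [h1]
  field_simp

/-- In the critically loaded regime,
√(k/f_k) · ∑_i α_i E_{s_i^(k)}(λ^(k) α_i d_i) → θ ∑_i (α_i/θ_i) φ(θ_i)/Φ(θ_i). -/
theorem helper_probability_limit
    (C : ℕ) (hC : 0 < C) (n : Fin C → ℕ) (hn : ∀ i, 0 < n i)
    (α d : Fin C → ℝ) (hα : ∀ i, 0 < α i) (hd : ∀ i, 0 < d i)
    (hsum : ∑ i, α i = 1)
    (f : ℕ → ℕ) (hf : ∀ k, 0 < f k)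
    (hfk : Tendsto (fun k : ℕ => (f k : ℝ) / k) atTop (𝓝 0))
    (θ : ℝ) (hθ : 0 < θ) (lam : ℕ → ℝ) (hlam : ∀ k, 0 < lam k)
    (hcrit : Tendsto
      (fun k : ℕ => (1 - lam k * totDemand n α d * f k / k) * Real.sqrt ((k : ℝ) / f k))
      atTop (𝓝 θ)) :
    Tendsto
      (fun k : ℕ =>
        Real.sqrt ((k : ℝ) / f k) *
          ∑ i, α i * erlangB (srv n α d f i k) (lam k * α i * d i))
      atTop
      (𝓝 (θ * ∑ i, (α i / thetaI n α d θ i) *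
        (stdGaussianPDF (thetaI n α d θ i) / stdGaussianCDF (thetaI n α d θ i)))) := by
  have hrel : ∀ i, 0 < relDemand n α d i := fun i =>
    mul_pos (mul_pos (hα i) (hd i)) (by exact_mod_cast hn i)
  have htot : 0 < totDemand n α d :=
    Finset.sum_pos (fun i _ => hrel i) ⟨⟨0, hC⟩, Finset.mem_univ _⟩
  have hm : Tendsto (fun k : ℕ => (k : ℝ) / f k) atTop atTop := by
    have h : Tendsto (fun k : ℕ => (f k : ℝ) / k) atTop (𝓝[>] 0) := by
      refine tendsto_nhdsWithin_iff.2 ⟨hfk, ?_⟩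
      filter_upwards [eventually_gt_atTop 0] with k hk
      have hk' : (0 : ℝ) < k := by exact_mod_cast hk
      have hf' : (0 : ℝ) < f k := by exact_mod_cast hf k
      exact div_pos hf' hk'
    refine (tendsto_inv_nhdsGT_zero.comp h).congr fun k => ?_
    simp
  simp_rw [Finset.mul_sum]
  refine tendsto_finsetSum _ fun i _ => ?_
  have hni : (0 : ℝ) < n i := by exact_mod_cast hn i
  have hαi := hα i
  have hdi := hd i
  set b := relDemand n α d i / (n i * totDemand n α d) with hb
  have hb0 : 0 < b := div_pos (hrel i) (mul_pos hni htot)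
  have hθi : thetaI n α d θ i = θ * √b := rfl
  have h := (tendsto_sqrt_mul_erlangB_of_critical (s := srv n α d f i) hb0 hm
    (by
      filter_upwards [eventually_gt_atTop 0] with k hk
      exact abs_srv_sub_le hn htot hk (hf k) (hrel i))
    (by
      filter_upwards [eventually_gt_atTop 0] with k hk
      have hk' : (0 : ℝ) < k := by exact_mod_cast hk
      have hf' : (0 : ℝ) < f k := by exact_mod_cast hf k
      have hl := hlam k
      positivity)
    hcrit).const_mul (α i)
  have hlim : α i * ((√b)⁻¹ * (stdGaussianPDF (θ * √b) / stdGaussianCDF (θ * √b))) =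
      θ * (α i / thetaI n α d θ i *
        (stdGaussianPDF (thetaI n α d θ i) / stdGaussianCDF (thetaI n α d θ i))) := by
    rw [hθi]
    field_simp
  rw [hlim] at h
  refine h.congr' ?_
  filter_upwards [eventually_gt_atTop 0] with k hk
  have hk' : (0 : ℝ) < k := by exact_mod_cast hk
  have hf' : (0 : ℝ) < f k := by exact_mod_cast hf k
  have hload : (k : ℝ) / f k * b * (lam k * totDemand n α d * f k / k) = lam k * α i * d i := by
    rw [hb, relDemand]
    field_simp
  rw [hload]
  ring
end
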